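/- Let d be a prime number. Then the order of the quotient group C(d)/Cc(d) equals d³(d²−1). -/

import Mathlib

noncomputable section
open Matrix Complex

def dbar (d : ℕ) : ℕ := if d % 2 = 1 then d else 2 * d

lemma dvd_dbar (d : ℕ) : d ∣ dbar d := by
  unfold dbar; split_ifs
  · exact dvd_rfl
  · exact Dvd.intro_left 2 rfl

def omega (d : ℕ) : ℂ := Complex.exp (2 * Real.pi * Complex.I / d)
def tau (d : ℕ) : ℂ := -Complex.exp (Real.pi * Complex.I / d)
def Tmat (d : ℕ) : Matrix (Fin d) (Fin d) ℂ :=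
  Matrix.diagonal fun r => omega d ^ (r : ℕ)
def Smat (d : ℕ) : Matrix (Fin d) (Fin d) ℂ :=
  Matrix.of fun r s => if (r : ℕ) = ((s : ℕ) + 1) % d then 1 else 0
def Dmat (d : ℕ) (p : ℤ × ℤ) : Matrix (Fin d) (Fin d) ℂ :=
  tau d ^ (p.1 * p.2) • (Smat d ^ p.1 * Tmat d ^ p.2)
def symp (p q : ℤ × ℤ) : ℤ := p.2 * q.1 - p.1 * q.2
def Fapp (F : Matrix (Fin 2) (Fin 2) ℤ) (p : ℤ × ℤ) : ℤ × ℤ :=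
  (F 0 0 * p.1 + F 0 1 * p.2, F 1 0 * p.1 + F 1 1 * p.2)
def Wset (d : ℕ) : Set (Matrix (Fin d) (Fin d) ℂ) :=
  {M | ∃ ξ : ℝ, ∃ p : ℤ × ℤ, M = Complex.exp (ξ * Complex.I) • Dmat d p}

/-- The Clifford group `C(d)`: the normalizer of `W(d)` inside the unitary group. -/
def Cliff (d : ℕ) : Subgroup (Matrix.unitaryGroup (Fin d) ℂ) where
  carrier := {U | (fun M => (U : Matrix (Fin d) (Fin d) ℂ) * M * (U : Matrix (Fin d) (Fin d) ℂ)ᴴ) '' Wset d = Wset d}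
  one_mem' := by
    simp only [Set.mem_setOf_eq, OneMemClass.coe_one, Matrix.one_mul, conjTranspose_one,
      Matrix.mul_one]
    exact Set.image_id _
  mul_mem' := by
    intro U V hU hV
    simp only [Set.mem_setOf_eq] at *
    have h : (fun M => ((U * V : Matrix.unitaryGroup (Fin d) ℂ) : Matrix (Fin d) (Fin d) ℂ) * M *
          ((U * V : Matrix.unitaryGroup (Fin d) ℂ) : Matrix (Fin d) (Fin d) ℂ)ᴴ) =
        (fun M => (U : Matrix (Fin d) (Fin d) ℂ) * M * (U : Matrix (Fin d) (Fin d) ℂ)ᴴ) ∘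
        (fun M => (V : Matrix (Fin d) (Fin d) ℂ) * M * (V : Matrix (Fin d) (Fin d) ℂ)ᴴ) := by
      funext M
      simp [Function.comp, Matrix.conjTranspose_mul, Matrix.mul_assoc]
    rw [h, Set.image_comp, hV, hU]
  inv_mem' := by
    intro U hU
    simp only [Set.mem_setOf_eq] at *
    have hsm : (U : Matrix (Fin d) (Fin d) ℂ)ᴴ * (U : Matrix (Fin d) (Fin d) ℂ) = 1 :=
      Matrix.UnitaryGroup.star_mul_self U
    have key : ((fun M => ((U⁻¹ : Matrix.unitaryGroup (Fin d) ℂ) : Matrix (Fin d) (Fin d) ℂ) * M *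
          ((U⁻¹ : Matrix.unitaryGroup (Fin d) ℂ) : Matrix (Fin d) (Fin d) ℂ)ᴴ) ∘
        (fun M => (U : Matrix (Fin d) (Fin d) ℂ) * M * (U : Matrix (Fin d) (Fin d) ℂ)ᴴ)) = id := by
      funext M
      show (U : Matrix (Fin d) (Fin d) ℂ)ᴴ *
          ((U : Matrix (Fin d) (Fin d) ℂ) * M * (U : Matrix (Fin d) (Fin d) ℂ)ᴴ) *
          ((U : Matrix (Fin d) (Fin d) ℂ)ᴴ)ᴴ = M
      rw [Matrix.conjTranspose_conjTranspose]
      calc (U : Matrix (Fin d) (Fin d) ℂ)ᴴ *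
            ((U : Matrix (Fin d) (Fin d) ℂ) * M * (U : Matrix (Fin d) (Fin d) ℂ)ᴴ) *
            (U : Matrix (Fin d) (Fin d) ℂ)
          = ((U : Matrix (Fin d) (Fin d) ℂ)ᴴ * (U : Matrix (Fin d) (Fin d) ℂ)) * M *
              ((U : Matrix (Fin d) (Fin d) ℂ)ᴴ * (U : Matrix (Fin d) (Fin d) ℂ)) := by
            simp only [Matrix.mul_assoc]
        _ = M := by rw [hsm]; simp
    conv_lhs => rw [← hU]
    rw [← Set.image_comp, key, Set.image_id]

/-- The subgroup `Cc(d)` of scalar multiples of the identity inside `C(d)`. -/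
def CcSub (d : ℕ) : Subgroup (Cliff d) where
  carrier := {U | ∃ c : ℂ, ((U : Matrix.unitaryGroup (Fin d) ℂ) : Matrix (Fin d) (Fin d) ℂ) = c • (1 : Matrix (Fin d) (Fin d) ℂ)}
  one_mem' := ⟨1, by simp⟩
  mul_mem' := by
    rintro a b ⟨c, hc⟩ ⟨c', hc'⟩
    exact ⟨c * c', by push_cast [hc, hc', smul_smul]; simp [hc, hc', smul_smul, mul_comm]⟩
  inv_mem' := by
    rintro a ⟨c, hc⟩
    refine ⟨(starRingEnd ℂ) c, ?_⟩
    calc (((a⁻¹ : Cliff d) : Matrix.unitaryGroup (Fin d) ℂ) : Matrix (Fin d) (Fin d) ℂ)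
        = (((a : Matrix.unitaryGroup (Fin d) ℂ) : Matrix (Fin d) (Fin d) ℂ))ᴴ := rfl
      _ = (c • (1 : Matrix (Fin d) (Fin d) ℂ))ᴴ := by rw [hc]
      _ = (starRingEnd ℂ) c • 1 := by simp

instance CcNormal (d : ℕ) : (CcSub d).Normal := by
  constructor
  rintro n ⟨c, hc⟩ g
  refine ⟨c, ?_⟩
  have hms : ((g : Matrix.unitaryGroup (Fin d) ℂ) : Matrix (Fin d) (Fin d) ℂ) *
      ((g : Matrix.unitaryGroup (Fin d) ℂ) : Matrix (Fin d) (Fin d) ℂ)ᴴ = 1 := by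
    have := Matrix.mem_unitaryGroup_iff.mp (g : Matrix.unitaryGroup (Fin d) ℂ).2
    simpa [Matrix.star_eq_conjTranspose] using this
  calc (((g * n * g⁻¹ : Cliff d) : Matrix.unitaryGroup (Fin d) ℂ) : Matrix (Fin d) (Fin d) ℂ)
      = ((g : Matrix.unitaryGroup (Fin d) ℂ) : Matrix (Fin d) (Fin d) ℂ) *
          ((n : Matrix.unitaryGroup (Fin d) ℂ) : Matrix (Fin d) (Fin d) ℂ) *
          ((g : Matrix.unitaryGroup (Fin d) ℂ) : Matrix (Fin d) (Fin d) ℂ)ᴴ := rfl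
    _ = c • (1 : Matrix (Fin d) (Fin d) ℂ) := by
        rw [hc]
        simp [Matrix.mul_smul, Matrix.smul_mul, hms]

/-! ### The order of `SL(2, 𝔽_d)` -/

lemma card_SL_two (F : Type*) [Field F] [Fintype F] :
    Nat.card (SpecialLinearGroup (Fin 2) F) = Fintype.card F * (Fintype.card F ^ 2 - 1) := by
  have hrange : (SpecialLinearGroup.toGL (n := Fin 2) (R := F)).range =
      (GeneralLinearGroup.det (n := Fin 2) (R := F)).ker := by
    ext g
    simp only [MonoidHom.mem_range, MonoidHom.mem_ker]
    constructor
    · rintro ⟨A, rfl⟩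
      ext
      simp
    · intro h
      have h' : (g : Matrix (Fin 2) (Fin 2) F).det = 1 := by
        have := congrArg Units.val h
        simpa using this
      exact ⟨⟨g, h'⟩, by ext; rfl⟩
  have hsurj : Function.Surjective (GeneralLinearGroup.det (n := Fin 2) (R := F)) := by
    intro u
    refine ⟨GeneralLinearGroup.mkOfDetNeZero !![(u : F), 0; 0, 1] (by simp), ?_⟩
    ext
    simp [GeneralLinearGroup.mkOfDetNeZero]
  have hcard := Subgroup.card_eq_card_quotient_mul_card_subgroup
    (GeneralLinearGroup.det (n := Fin 2) (R := F)).ker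
  rw [Nat.card_congr (QuotientGroup.quotientKerEquivOfSurjective _ hsurj).toEquiv, ← hrange,
    ← Nat.card_congr (MonoidHom.ofInjective SpecialLinearGroup.toGL_injective).toEquiv,
    card_GL_field, Nat.card_units, Nat.card_eq_fintype_card] at hcard
  have hq : 1 < Fintype.card F := Fintype.one_lt_card
  simp only [Fin.prod_univ_two, Fin.val_zero, Fin.val_one, pow_zero, pow_one] at hcard
  have hf : Fintype.card F ^ 2 - Fintype.card F = (Fintype.card F - 1) * Fintype.card F := by
    rw [Nat.sub_mul, sq, one_mul]
  apply Nat.eq_of_mul_eq_mul_left (Nat.sub_pos_of_lt hq)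
  rw [← hcard, hf]
  ring

/-! ### Displacement operators indexed by `ZMod d` -/

section Displacement

variable {d : ℕ} [NeZero d]

/-- The index set `Fin d` identified with `ZMod d`. -/
def finZMod (d : ℕ) [NeZero d] : Fin d ≃ ZMod d where
  toFun r := ((r : ℕ) : ZMod d)
  invFun z := ⟨z.val, z.val_lt⟩
  left_inv r := by ext; simp [ZMod.val_natCast, Nat.mod_eq_of_lt r.2]
  right_inv z := by simp

lemma finZMod_apply (r : Fin d) : finZMod d r = ((r : ℕ) : ZMod d) := rfl

/-- The unnormalized displacement operator `S ^ x * T ^ y`, with `x` and `y` taken modulo `d`. -/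
def weyl (x y : ZMod d) : Matrix (Fin d) (Fin d) ℂ :=
  Matrix.of fun r s =>
    if finZMod d r = finZMod d s + x then ZMod.stdAddChar (y * finZMod d s) else 0

lemma weyl_mul_apply (x y : ZMod d) (X : Matrix (Fin d) (Fin d) ℂ) (r s : Fin d) :
    (weyl x y * X) r s = ZMod.stdAddChar (y * (finZMod d r - x)) *
      X ((finZMod d).symm (finZMod d r - x)) s := by
  rw [Matrix.mul_apply, Finset.sum_eq_single ((finZMod d).symm (finZMod d r - x))]
  · simp [weyl]
  · intro k _ hk
    have : finZMod d r ≠ finZMod d k + x := by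
      intro h
      exact hk (by simp [h])
    simp [weyl, this]
  · simp

lemma mul_weyl_apply (x y : ZMod d) (X : Matrix (Fin d) (Fin d) ℂ) (r s : Fin d) :
    (X * weyl x y) r s = X r ((finZMod d).symm (finZMod d s + x)) *
      ZMod.stdAddChar (y * finZMod d s) := by
  rw [Matrix.mul_apply, Finset.sum_eq_single ((finZMod d).symm (finZMod d s + x))]
  · simp [weyl]
  · intro k _ hk
    have : finZMod d k ≠ finZMod d s + x := by
      intro h
      exact hk (by simp [← h])
    simp [weyl, this]
  · simp

lemma weyl_mul_weyl (x y x' y' : ZMod d) :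
    weyl x y * weyl x' y' = (ZMod.stdAddChar (y * x') : ℂ) • weyl (x + x') (y + y') := by
  ext r s
  rw [mul_weyl_apply]
  simp only [weyl, Matrix.of_apply, Matrix.smul_apply, Equiv.apply_symm_apply, smul_eq_mul]
  have h : finZMod d s + x' + x = finZMod d s + (x + x') := by ring
  rw [h]
  split_ifs
  · rw [← AddChar.map_add_eq_mul, ← AddChar.map_add_eq_mul]
    congr 1
    ring
  · simp

lemma weyl_zero : (weyl 0 0 : Matrix (Fin d) (Fin d) ℂ) = 1 := by
  ext r s
  simp [weyl, Matrix.one_apply]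

lemma weyl_conjTranspose (x y : ZMod d) :
    (weyl x y)ᴴ = (ZMod.stdAddChar (x * y) : ℂ) • weyl (-x) (-y) := by
  ext r s
  simp only [weyl, Matrix.conjTranspose_apply, Matrix.of_apply, Matrix.smul_apply, smul_eq_mul]
  by_cases h : finZMod d s = finZMod d r + x
  · have h' : finZMod d r = finZMod d s + -x := by rw [h]; ring
    rw [if_pos h, if_pos h', ← AddChar.map_add_eq_mul, ← starRingEnd_apply,
      ← AddChar.map_neg_eq_conj, h]
    congr 1
    ring
  · have h' : ¬ finZMod d r = finZMod d s + -x := by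
      intro h'
      exact h (by rw [h']; ring)
    simp [h, h']

lemma weyl_mul_conjTranspose (x y : ZMod d) : weyl x y * (weyl x y)ᴴ = 1 := by
  rw [weyl_conjTranspose, Matrix.mul_smul, weyl_mul_weyl, smul_smul, ← AddChar.map_add_eq_mul]
  simp [weyl_zero, mul_comm]

lemma weyl_ne_zero (x y : ZMod d) : weyl x y ≠ 0 := by
  intro h
  have := weyl_mul_conjTranspose x y
  rw [h, Matrix.zero_mul] at this
  exact zero_ne_one this

lemma stdAddChar_ne_zero (x : ZMod d) : (ZMod.stdAddChar x : ℂ) ≠ 0 := by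
  rw [← norm_ne_zero_iff, AddChar.norm_apply]
  exact one_ne_zero

/-- The commutation phase of two displacement operators is given by the symplectic form. -/
lemma weyl_commutator {x y x' y' k : ZMod d}
    (h : weyl x' y' * weyl x y = (ZMod.stdAddChar k : ℂ) • (weyl x y * weyl x' y')) :
    y' * x = k + y * x' := by
  rw [weyl_mul_weyl, weyl_mul_weyl, smul_smul, add_comm x' x, add_comm y' y,
    ← AddChar.map_add_eq_mul] at h
  exact ZMod.injective_stdAddChar (smul_left_injective ℂ (weyl_ne_zero _ _) h)

lemma weyl_mul_comm (x y x' y' : ZMod d) :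
    weyl x' y' * weyl x y = (ZMod.stdAddChar (y' * x - y * x') : ℂ) •
      (weyl x y * weyl x' y') := by
  rw [weyl_mul_weyl, weyl_mul_weyl, smul_smul, add_comm x' x, add_comm y' y,
    ← AddChar.map_add_eq_mul]
  congr 2
  ring

/-- Displacement operators with different labels are not proportional. -/
lemma weyl_label_unique {x y x' y' : ZMod d} {c c' : ℂ} (hc : c ≠ 0)
    (h : c • weyl x y = c' • weyl x' y') : x = x' ∧ y = y' := by
  have key : ∀ u v : ZMod d, v * x - y * u = v * x' - y' * u := by
    intro u v
    have h1 : weyl u v * (c • weyl x y) = weyl u v * (c' • weyl x' y') := by rw [h]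
    rw [Matrix.mul_smul, Matrix.mul_smul, weyl_mul_comm x y u v, weyl_mul_comm x' y' u v,
      smul_comm c, smul_comm c', ← Matrix.smul_mul c, ← Matrix.smul_mul c', ← h] at h1
    refine ZMod.injective_stdAddChar (smul_left_injective ℂ ?_ h1)
    rw [Matrix.smul_mul, weyl_mul_weyl, smul_smul]
    exact smul_ne_zero (mul_ne_zero hc (stdAddChar_ne_zero _)) (weyl_ne_zero _ _)
  have h1 := key 0 1
  have h2 := key 1 0
  simp only [one_mul, mul_zero, sub_zero, zero_mul, mul_one, zero_sub, neg_inj] at h1 h2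
  exact ⟨h1, h2⟩

lemma weyl_pow (x y : ZMod d) (n : ℕ) :
    ∃ c : ℂ, ‖c‖ = 1 ∧ weyl x y ^ n = c • weyl ((n : ZMod d) * x) ((n : ZMod d) * y) := by
  induction n with
  | zero => exact ⟨1, by simp, by simp [weyl_zero]⟩
  | succ n ih =>
    obtain ⟨c, hc, h⟩ := ih
    refine ⟨c * ZMod.stdAddChar (((n : ZMod d) * y) * x), by simp [hc, AddChar.norm_apply], ?_⟩
    rw [pow_succ, h, Matrix.smul_mul, weyl_mul_weyl, smul_smul]
    push_cast
    ring_nf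

lemma weyl_one_zero_pow (n : ℕ) : (weyl 1 0 : Matrix (Fin d) (Fin d) ℂ) ^ n = weyl n 0 := by
  induction n with
  | zero => simp [weyl_zero]
  | succ n ih => rw [pow_succ, ih, weyl_mul_weyl]; simp

lemma weyl_zero_one_pow (n : ℕ) : (weyl 0 1 : Matrix (Fin d) (Fin d) ℂ) ^ n = weyl 0 n := by
  induction n with
  | zero => simp [weyl_zero]
  | succ n ih => rw [pow_succ, ih, weyl_mul_weyl]; simp

lemma weyl_eq_pow (x y : ZMod d) : weyl x y = weyl 1 0 ^ x.val * weyl 0 1 ^ y.val := by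
  rw [weyl_one_zero_pow, weyl_zero_one_pow, weyl_mul_weyl]
  simp

lemma exists_phase_pow_eq_one (x y : ZMod d) :
    ∃ c : ℂ, ‖c‖ = 1 ∧ (c • weyl x y) ^ d = 1 := by
  obtain ⟨b, hb, h⟩ := weyl_pow x y d
  obtain ⟨c, hc⟩ := IsAlgClosed.exists_pow_nat_eq b⁻¹ (Nat.pos_of_ne_zero (NeZero.ne d))
  have hb0 : b ≠ 0 := by
    rw [← norm_ne_zero_iff, hb]
    exact one_ne_zero
  refine ⟨c, ?_, ?_⟩
  · rw [← pow_eq_one_iff_of_nonneg (norm_nonneg c) (NeZero.ne d), ← norm_pow, hc, norm_inv, hb,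
      inv_one]
  · rw [smul_pow, h, hc, smul_smul, inv_mul_cancel₀ hb0]
    simp [weyl_zero]

lemma stdAddChar_natCast_pow (n : ℕ) : (ZMod.stdAddChar (n : ZMod d) : ℂ) = omega d ^ n := by
  have h : (ZMod.stdAddChar (1 : ZMod d) : ℂ) = omega d := by
    have := ZMod.stdAddChar_coe (N := d) 1
    simpa [omega] using this
  rw [← h, ← AddChar.map_nsmul_eq_pow]
  simp

lemma stdAddChar_pow_card (k : ZMod d) : (ZMod.stdAddChar k : ℂ) ^ d = 1 := by
  rw [← AddChar.map_nsmul_eq_pow]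
  simp

lemma exists_stdAddChar_eq {z : ℂ} (hz : z ^ d = 1) : ∃ k : ZMod d, z = ZMod.stdAddChar k := by
  obtain ⟨i, -, hi⟩ :=
    (Complex.isPrimitiveRoot_exp d (NeZero.ne d)).eq_pow_of_pow_eq_one hz
  exact ⟨i, by rw [stdAddChar_natCast_pow, ← hi, omega]⟩

/-- A matrix commuting with the clock and shift matrices is scalar. -/
lemma eq_smul_one_of_commute {X : Matrix (Fin d) (Fin d) ℂ}
    (hS : X * weyl 1 0 = weyl 1 0 * X) (hT : X * weyl 0 1 = weyl 0 1 * X) :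
    X = X 0 0 • (1 : Matrix (Fin d) (Fin d) ℂ) := by
  have hoff : ∀ r s, r ≠ s → X r s = 0 := by
    intro r s hrs
    have h := congrFun (congrFun hT r) s
    rw [weyl_mul_apply, mul_weyl_apply] at h
    simp only [add_zero, sub_zero, one_mul, Equiv.symm_apply_apply] at h
    by_contra hX
    rw [mul_comm, mul_left_inj' hX] at h
    exact hrs ((finZMod d).injective (ZMod.injective_stdAddChar h)).symm
  have hstep : ∀ z : ZMod d, X ((finZMod d).symm (z + 1)) ((finZMod d).symm (z + 1)) =
      X ((finZMod d).symm z) ((finZMod d).symm z) := by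
    intro z
    have h := congrFun (congrFun hS ((finZMod d).symm (z + 1))) ((finZMod d).symm z)
    rw [weyl_mul_apply, mul_weyl_apply] at h
    simpa using h
  have hnat : ∀ n : ℕ, X ((finZMod d).symm n) ((finZMod d).symm n) = X 0 0 := by
    intro n
    induction n with
    | zero =>
      have : (finZMod d).symm ((0 : ℕ) : ZMod d) = 0 := by
        rw [Equiv.symm_apply_eq]
        simp [finZMod_apply]
      rw [this]
    | succ n ih => push_cast; rw [hstep, ih]
  ext r s
  by_cases hrs : r = s
  · subst hrs
    have := hnat r
    rw [← finZMod_apply, Equiv.symm_apply_apply] at this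
    simp [this]
  · simp [hoff r s hrs, hrs]

end Displacement

/-! ### The generalized Pauli group -/

section Pauli

variable {d : ℕ} [NeZero d]

lemma Tmat_eq_weyl : Tmat d = weyl 0 1 := by
  ext r s
  by_cases h : r = s
  · subst h
    simp [Tmat, weyl, finZMod_apply, stdAddChar_natCast_pow]
  · simp [Tmat, weyl, h]

lemma Smat_eq_weyl : Smat d = weyl 1 0 := by
  ext r s
  have h : ((r : ℕ) = ((s : ℕ) + 1) % d) ↔ finZMod d r = finZMod d s + 1 := by
    rw [finZMod_apply, finZMod_apply, ← Nat.cast_succ, ZMod.natCast_eq_natCast_iff',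
      Nat.mod_eq_of_lt r.2]
  simp [Smat, weyl, h]

lemma weyl_one_zero_zpow (n : ℤ) : (weyl 1 0 : Matrix (Fin d) (Fin d) ℂ) ^ n = weyl n 0 := by
  cases n with
  | ofNat n => simpa using weyl_one_zero_pow n
  | negSucc n =>
    rw [zpow_negSucc, weyl_one_zero_pow]
    apply Matrix.inv_eq_left_inv
    rw [weyl_mul_weyl]
    simp [weyl_zero]

lemma weyl_zero_one_zpow (n : ℤ) : (weyl 0 1 : Matrix (Fin d) (Fin d) ℂ) ^ n = weyl 0 n := by
  cases n with
  | ofNat n => simpa using weyl_zero_one_pow n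
  | negSucc n =>
    rw [zpow_negSucc, weyl_zero_one_pow]
    apply Matrix.inv_eq_left_inv
    rw [weyl_mul_weyl]
    simp [weyl_zero]

lemma Dmat_eq_weyl (p : ℤ × ℤ) : Dmat d p = tau d ^ (p.1 * p.2) • weyl (p.1 : ZMod d) p.2 := by
  rw [Dmat, Smat_eq_weyl, Tmat_eq_weyl, weyl_one_zero_zpow, weyl_zero_one_zpow, weyl_mul_weyl]
  simp

lemma norm_tau (d : ℕ) : ‖tau d‖ = 1 := by
  rw [tau, norm_neg, Complex.norm_eq_one_iff]
  refine ⟨Real.pi / d, ?_⟩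
  push_cast
  ring_nf

lemma mem_Wset_iff {M : Matrix (Fin d) (Fin d) ℂ} :
    M ∈ Wset d ↔ ∃ c : ℂ, ‖c‖ = 1 ∧ ∃ x y : ZMod d, M = c • weyl x y := by
  constructor
  · rintro ⟨ξ, p, rfl⟩
    refine ⟨Complex.exp (ξ * Complex.I) * tau d ^ (p.1 * p.2), ?_, p.1, p.2, ?_⟩
    · rw [norm_mul, norm_zpow, norm_tau, _root_.one_zpow, Complex.norm_exp_ofReal_mul_I, one_mul]
    · rw [Dmat_eq_weyl, smul_smul]
  · rintro ⟨c, hc, x, y, rfl⟩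
    obtain ⟨a, rfl⟩ := ZMod.intCast_surjective x
    obtain ⟨b, rfl⟩ := ZMod.intCast_surjective y
    have hτ : ‖(tau d ^ (a * b))‖ = 1 := by rw [norm_zpow, norm_tau, _root_.one_zpow]
    have hτ0 : tau d ^ (a * b) ≠ 0 := by
      rw [← norm_ne_zero_iff, hτ]
      exact one_ne_zero
    obtain ⟨ξ, hξ⟩ := (Complex.norm_eq_one_iff (c / tau d ^ (a * b))).1 (by
      rw [norm_div, hc, hτ, div_one])
    refine ⟨ξ, (a, b), ?_⟩
    rw [hξ, Dmat_eq_weyl, smul_smul, div_mul_cancel₀ _ hτ0]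

end Pauli

/-! ### Pairs of unitaries satisfying the Weyl relations -/

section Intertwiner

variable {d : ℕ} [NeZero d]

lemma clock_mul_shift_pow {A B : Matrix (Fin d) (Fin d) ℂ}
    (hAB : B * A = (ZMod.stdAddChar (1 : ZMod d) : ℂ) • (A * B)) (n : ℕ) :
    B * A ^ n = (ZMod.stdAddChar (n : ZMod d) : ℂ) • (A ^ n * B) := by
  induction n with
  | zero => simp
  | succ n ih =>
    rw [pow_succ, ← Matrix.mul_assoc, ih, Matrix.smul_mul, Matrix.mul_assoc, hAB,
      Matrix.mul_smul, smul_smul, Matrix.mul_assoc, Nat.cast_succ, AddChar.map_add_eq_mul]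

lemma exists_fixed_vector {A B : Matrix (Fin d) (Fin d) ℂ} (hA : A ^ d = 1) (hB : B ^ d = 1)
    (hAB : B * A = (ZMod.stdAddChar (1 : ZMod d) : ℂ) • (A * B)) :
    ∃ v : Fin d → ℂ, v ≠ 0 ∧ B *ᵥ v = v := by
  obtain ⟨μ, hμ⟩ := Module.End.exists_eigenvalue (Matrix.toLin' B)
  obtain ⟨v, hv⟩ := hμ.exists_hasEigenvector
  have hv0 : v ≠ 0 := hv.2
  have hBv : B *ᵥ v = μ • v := by simpa using hv.apply_eq_smul
  have hpow : ∀ n : ℕ, B ^ n *ᵥ v = μ ^ n • v := by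
    intro n
    induction n with
    | zero => simp
    | succ n ih =>
      rw [pow_succ, ← Matrix.mulVec_mulVec, hBv, Matrix.mulVec_smul, ih, smul_smul, pow_succ,
        mul_comm]
  have hμd : μ ^ d = 1 := by
    have h := hpow d
    rw [hB, Matrix.one_mulVec] at h
    exact smul_left_injective ℂ hv0 (by simpa using h.symm)
  obtain ⟨k, rfl⟩ := exists_stdAddChar_eq hμd
  refine ⟨A ^ (-k).val *ᵥ v, ?_, ?_⟩
  · intro h0
    apply hv0
    have hinv : A ^ ((d - 1) * (-k).val) * A ^ (-k).val = 1 := by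
      rw [← pow_add, ← Nat.succ_mul, Nat.succ_eq_add_one,
        Nat.sub_add_cancel (Nat.pos_of_ne_zero (NeZero.ne d)), pow_mul, hA, one_pow]
    rw [← Matrix.one_mulVec v, ← hinv, ← Matrix.mulVec_mulVec, h0, Matrix.mulVec_zero]
  · rw [Matrix.mulVec_mulVec, clock_mul_shift_pow hAB, Matrix.smul_mulVec,
      ← Matrix.mulVec_mulVec, hBv, Matrix.mulVec_smul, smul_smul, ← AddChar.map_add_eq_mul]
    simp

open ComplexOrder in
lemma exists_unit_fixed_vector {A B : Matrix (Fin d) (Fin d) ℂ} (hA : A ^ d = 1) (hB : B ^ d = 1)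
    (hAB : B * A = (ZMod.stdAddChar (1 : ZMod d) : ℂ) • (A * B)) :
    ∃ v : Fin d → ℂ, star v ⬝ᵥ v = 1 ∧ B *ᵥ v = v := by
  obtain ⟨v, hv0, hv⟩ := exists_fixed_vector hA hB hAB
  have hpos : 0 < star v ⬝ᵥ v := Matrix.dotProduct_star_self_pos_iff.2 hv0
  obtain ⟨hre, him⟩ := Complex.pos_iff.1 hpos
  set t : ℝ := (star v ⬝ᵥ v).re
  have ht : star v ⬝ᵥ v = (t : ℂ) := by
    apply Complex.ext
    · rfl
    · simpa using him.symm
  refine ⟨((Real.sqrt t)⁻¹ : ℂ) • v, ?_, by rw [Matrix.mulVec_smul, hv]⟩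
  have hs : ((Real.sqrt t : ℝ) : ℂ) * (Real.sqrt t : ℝ) = t := by
    rw [← Complex.ofReal_mul, Real.mul_self_sqrt hre.le]
  have ht0 : (t : ℂ) ≠ 0 := by exact_mod_cast hre.ne'
  have hs0 : ((Real.sqrt t : ℝ) : ℂ) ≠ 0 := by
    intro h
    rw [h, zero_mul] at hs
    exact ht0 hs.symm
  rw [star_smul, smul_dotProduct, dotProduct_smul, ht, ← hs]
  simp [hs0]

/-- Unitaries obeying the Weyl relations are simultaneously conjugate to shift and clock. -/
lemma exists_unitary_intertwiner {A B : Matrix (Fin d) (Fin d) ℂ}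
    (hAu : Aᴴ * A = 1) (hBu : Bᴴ * B = 1) (hA : A ^ d = 1) (hB : B ^ d = 1)
    (hAB : B * A = (ZMod.stdAddChar (1 : ZMod d) : ℂ) • (A * B)) :
    ∃ U : Matrix (Fin d) (Fin d) ℂ, Uᴴ * U = 1 ∧ U * weyl 1 0 = A * U ∧ U * weyl 0 1 = B * U := by
  obtain ⟨v, hv1, hv⟩ := exists_unit_fixed_vector hA hB hAB
  set U : Matrix (Fin d) (Fin d) ℂ := Matrix.of fun r c => (A ^ (c : ℕ) *ᵥ v) r with hU
  have hmul : ∀ (X : Matrix (Fin d) (Fin d) ℂ) (r c : Fin d),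
      (X * U) r c = (X *ᵥ (A ^ (c : ℕ) *ᵥ v)) r := fun X r c => rfl
  have hUS : U * weyl 1 0 = A * U := by
    ext r c
    rw [mul_weyl_apply, hmul, Matrix.mulVec_mulVec, ← pow_succ']
    have hval : (((finZMod d).symm (finZMod d c + 1) : Fin d) : ℕ) = ((c : ℕ) + 1) % d := by
      change (finZMod d c + 1).val = _
      rw [finZMod_apply, ← Nat.cast_succ, ZMod.val_natCast]
    rw [pow_eq_pow_mod _ hA, ← hval]
    simp [hU]
  have hUT : U * weyl 0 1 = B * U := by
    ext r c
    rw [mul_weyl_apply, hmul, Matrix.mulVec_mulVec, clock_mul_shift_pow hAB,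
      Matrix.smul_mulVec, ← Matrix.mulVec_mulVec, hv]
    rw [add_zero, Equiv.symm_apply_apply, one_mul, finZMod_apply]
    simp [hU, mul_comm]
  have hcomm : ∀ {W X : Matrix (Fin d) (Fin d) ℂ}, W * Wᴴ = 1 → Xᴴ * X = 1 → U * W = X * U →
      Uᴴ * U * W = W * (Uᴴ * U) := by
    intro W X hW hX h
    have h2 : Wᴴ * Uᴴ = Uᴴ * Xᴴ := by
      rw [← Matrix.conjTranspose_mul, ← Matrix.conjTranspose_mul, h]
    calc Uᴴ * U * W = (W * Wᴴ) * Uᴴ * (X * U) := by rw [hW, Matrix.one_mul, Matrix.mul_assoc, h]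
      _ = W * (Uᴴ * (Xᴴ * X) * U) := by
        rw [Matrix.mul_assoc W, h2]
        simp only [Matrix.mul_assoc]
      _ = W * (Uᴴ * U) := by rw [hX, Matrix.mul_one]
  have hscalar := eq_smul_one_of_commute (hcomm (weyl_mul_conjTranspose _ _) hAu hUS)
    (hcomm (weyl_mul_conjTranspose _ _) hBu hUT)
  refine ⟨U, ?_, hUS, hUT⟩
  have h00 : (Uᴴ * U) 0 0 = 1 := by
    rw [← hv1, Matrix.mul_apply]
    simp [hU, dotProduct]
  rw [hscalar, h00, one_smul]

end Intertwiner

/-! ### Conjugation by unitary matrices -/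

section Conjugation

variable {d : ℕ}

lemma unitary_conj_mul_conj {U : Matrix (Fin d) (Fin d) ℂ} (hU : Uᴴ * U = 1)
    (X Y : Matrix (Fin d) (Fin d) ℂ) : (U * X * Uᴴ) * (U * Y * Uᴴ) = U * (X * Y) * Uᴴ := by
  calc (U * X * Uᴴ) * (U * Y * Uᴴ) = U * X * (Uᴴ * U) * Y * Uᴴ := by
        simp only [Matrix.mul_assoc]
    _ = U * (X * Y) * Uᴴ := by
        rw [hU, Matrix.mul_one]
        simp only [Matrix.mul_assoc]

lemma unitary_conj_pow {U : Matrix (Fin d) (Fin d) ℂ} (hU : Uᴴ * U = 1)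
    (X : Matrix (Fin d) (Fin d) ℂ) (n : ℕ) : (U * X * Uᴴ) ^ n = U * X ^ n * Uᴴ := by
  induction n with
  | zero => simp [mul_eq_one_comm.1 hU]
  | succ n ih => rw [pow_succ, ih, unitary_conj_mul_conj hU, pow_succ]

lemma conjTranspose_mul_self (U : Matrix.unitaryGroup (Fin d) ℂ) : U.1ᴴ * U.1 = 1 :=
  Matrix.UnitaryGroup.star_mul_self U

lemma mul_conjTranspose_self (U : Matrix.unitaryGroup (Fin d) ℂ) : U.1 * U.1ᴴ = 1 :=
  mul_eq_one_comm.1 (conjTranspose_mul_self U)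

lemma conj_eq_conj_iff {U V : Matrix (Fin d) (Fin d) ℂ} (hU : Uᴴ * U = 1) (hV : Vᴴ * V = 1)
    (X : Matrix (Fin d) (Fin d) ℂ) :
    U * X * Uᴴ = V * X * Vᴴ ↔ Uᴴ * V * X = X * (Uᴴ * V) := by
  have hU' := mul_eq_one_comm.1 hU
  have hV' := mul_eq_one_comm.1 hV
  constructor
  · intro h
    calc Uᴴ * V * X = Uᴴ * (V * X * Vᴴ) * V := by
          rw [Matrix.mul_assoc Uᴴ, Matrix.mul_assoc Uᴴ, Matrix.mul_assoc (V * X), hV,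
            Matrix.mul_one]
      _ = (Uᴴ * U) * X * (Uᴴ * V) := by rw [← h]; simp only [Matrix.mul_assoc]
      _ = X * (Uᴴ * V) := by rw [hU, Matrix.one_mul]
  · intro h
    calc U * X * Uᴴ = U * (X * (Uᴴ * V)) * Vᴴ := by
          rw [Matrix.mul_assoc, Matrix.mul_assoc, Matrix.mul_assoc, Matrix.mul_assoc, hV',
            Matrix.mul_one]
      _ = (U * Uᴴ) * V * X * Vᴴ := by rw [← h]; simp only [Matrix.mul_assoc]
      _ = V * X * Vᴴ := by rw [hU', Matrix.one_mul]

end Conjugation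

/-! ### Parametrization of the Clifford group modulo phases -/

section Clifford

variable {d : ℕ} [NeZero d]

/-- The conjugates of the shift and clock matrices under a Clifford unitary. -/
def cliffPair (U : Cliff d) : Matrix (Fin d) (Fin d) ℂ × Matrix (Fin d) (Fin d) ℂ :=
  (U.1.1 * weyl 1 0 * U.1.1ᴴ, U.1.1 * weyl 0 1 * U.1.1ᴴ)

lemma cliffPair_eq_iff (U V : Cliff d) : cliffPair U = cliffPair V ↔ U⁻¹ * V ∈ CcSub d := by
  have hU := conjTranspose_mul_self U.1
  have hV := conjTranspose_mul_self V.1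
  rw [cliffPair, cliffPair, Prod.mk.injEq, conj_eq_conj_iff hU hV, conj_eq_conj_iff hU hV]
  change _ ↔ ∃ c : ℂ, U.1.1ᴴ * V.1.1 = c • (1 : Matrix (Fin d) (Fin d) ℂ)
  constructor
  · rintro ⟨hS, hT⟩
    exact ⟨_, eq_smul_one_of_commute hS hT⟩
  · rintro ⟨c, hc⟩
    simp [hc]

lemma card_quotient_eq :
    Nat.card (Cliff d ⧸ CcSub d) = Nat.card (Set.range (cliffPair (d := d))) := by
  let f : Cliff d ⧸ CcSub d → Matrix (Fin d) (Fin d) ℂ × Matrix (Fin d) (Fin d) ℂ :=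
    Quotient.lift cliffPair fun U V h =>
      (cliffPair_eq_iff U V).2 (QuotientGroup.leftRel_apply.1 h)
  have hf : Function.Injective f := by
    intro q q'
    induction q using QuotientGroup.induction_on with | _ U
    induction q' using QuotientGroup.induction_on with | _ V
    intro h
    exact QuotientGroup.eq.2 ((cliffPair_eq_iff U V).1 h)
  have hr : Set.range f = Set.range (cliffPair (d := d)) := Set.range_quot_lift _
  rw [← hr]
  exact Nat.card_congr (Equiv.ofInjective f hf)

/-- A phase normalizing the displacement operator `weyl x y` to have `d`-th power one. -/
def weylPhase (x y : ZMod d) : ℂ := (exists_phase_pow_eq_one x y).choose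

lemma norm_weylPhase (x y : ZMod d) : ‖weylPhase x y‖ = 1 :=
  (exists_phase_pow_eq_one x y).choose_spec.1

lemma weylPhase_smul_pow (x y : ZMod d) : (weylPhase x y • weyl x y) ^ d = 1 :=
  (exists_phase_pow_eq_one x y).choose_spec.2

lemma weylPhase_ne_zero (x y : ZMod d) : weylPhase x y ≠ 0 := by
  rw [← norm_ne_zero_iff, norm_weylPhase]
  exact one_ne_zero

/-- The phases for which a displacement operator has `d`-th power one. -/
lemma exists_phase_eq {c : ℂ} {x y : ZMod d} (h : (c • weyl x y) ^ d = 1) :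
    ∃ k : ZMod d, c = ZMod.stdAddChar k * weylPhase x y := by
  have h0 := weylPhase_ne_zero x y
  have h1 : (c / weylPhase x y) ^ d = 1 := by
    have h2 : (c • weyl x y) ^ d = (c / weylPhase x y) ^ d • (weylPhase x y • weyl x y) ^ d := by
      rw [← smul_pow, smul_smul, div_mul_cancel₀ _ h0]
    rw [h, weylPhase_smul_pow] at h2
    have h3 := congrFun (congrFun h2 0) 0
    simpa using h3.symm
  obtain ⟨k, hk⟩ := exists_stdAddChar_eq h1
  exact ⟨k, by rw [← hk, div_mul_cancel₀ _ h0]⟩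

/-- The pair of displacement operators labelled by the columns of a symplectic matrix, with
prescribed phases. -/
def symplecticPair (t : SpecialLinearGroup (Fin 2) (ZMod d) × ZMod d × ZMod d) :
    Matrix (Fin d) (Fin d) ℂ × Matrix (Fin d) (Fin d) ℂ :=
  ((ZMod.stdAddChar t.2.1 * weylPhase (t.1.1 0 0) (t.1.1 1 0)) • weyl (t.1.1 0 0) (t.1.1 1 0),
    (ZMod.stdAddChar t.2.2 * weylPhase (t.1.1 0 1) (t.1.1 1 1)) • weyl (t.1.1 0 1) (t.1.1 1 1))

lemma phase_label_injective {x y x' y' k k' : ZMod d}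
    (h : (ZMod.stdAddChar k * weylPhase x y) • weyl x y =
      (ZMod.stdAddChar k' * weylPhase x' y') • weyl x' y') : x = x' ∧ y = y' ∧ k = k' := by
  obtain ⟨rfl, rfl⟩ := weyl_label_unique
    (mul_ne_zero (stdAddChar_ne_zero k) (weylPhase_ne_zero x y)) h
  exact ⟨rfl, rfl, ZMod.injective_stdAddChar
    (mul_right_cancel₀ (weylPhase_ne_zero x y) (smul_left_injective ℂ (weyl_ne_zero _ _) h))⟩

lemma symplecticPair_injective : Function.Injective (symplecticPair (d := d)) := by
  rintro ⟨m, i, j⟩ ⟨m', i', j'⟩ h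
  obtain ⟨h1, h2⟩ := Prod.mk.inj h
  obtain ⟨h00, h10, rfl⟩ := phase_label_injective h1
  obtain ⟨h01, h11, rfl⟩ := phase_label_injective h2
  have : m = m' := by
    ext r s
    fin_cases r <;> fin_cases s
    exacts [h00, h01, h10, h11]
  rw [this]

lemma cliffPair_mem_range (U : Cliff d) : cliffPair U ∈ Set.range (symplecticPair (d := d)) := by
  have hU := conjTranspose_mul_self U.1
  have hmem : ∀ x y : ZMod d, U.1.1 * weyl x y * U.1.1ᴴ ∈ Wset d := by
    intro x y
    rw [← U.2]
    exact ⟨weyl x y, mem_Wset_iff.2 ⟨1, by simp, x, y, by simp⟩, rfl⟩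
  obtain ⟨a, ha, x, y, hA⟩ := mem_Wset_iff.1 (hmem 1 0)
  obtain ⟨b, hb, x', y', hB⟩ := mem_Wset_iff.1 (hmem 0 1)
  have ha0 : a ≠ 0 := by
    rw [← norm_ne_zero_iff, ha]
    exact one_ne_zero
  have hb0 : b ≠ 0 := by
    rw [← norm_ne_zero_iff, hb]
    exact one_ne_zero
  have hAd : (a • weyl x y) ^ d = 1 := by
    rw [← hA, unitary_conj_pow hU, weyl_one_zero_pow]
    simp [weyl_zero, mul_conjTranspose_self]
  have hBd : (b • weyl x' y') ^ d = 1 := by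
    rw [← hB, unitary_conj_pow hU, weyl_zero_one_pow]
    simp [weyl_zero, mul_conjTranspose_self]
  have hdet : y' * x = 1 + y * x' := by
    have h : (b • weyl x' y') * (a • weyl x y) =
        (ZMod.stdAddChar (1 : ZMod d) : ℂ) • ((a • weyl x y) * (b • weyl x' y')) := by
      rw [← hA, ← hB, unitary_conj_mul_conj hU, unitary_conj_mul_conj hU, weyl_mul_comm 1 0 0 1]
      simp
    rw [Matrix.smul_mul, Matrix.mul_smul, Matrix.smul_mul, Matrix.mul_smul, smul_smul b a,
      smul_smul a b, mul_comm b a, smul_comm _ (a * b)] at h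
    exact weyl_commutator (smul_right_injective _ (mul_ne_zero ha0 hb0) h)
  obtain ⟨i, rfl⟩ := exists_phase_eq hAd
  obtain ⟨j, rfl⟩ := exists_phase_eq hBd
  refine ⟨⟨⟨!![x, x'; y, y'], ?_⟩, i, j⟩, ?_⟩
  · rw [Matrix.det_fin_two_of, mul_comm x, hdet]
    ring
  · rw [cliffPair, hA, hB]
    rfl

lemma symplecticPair_mem_range (t : SpecialLinearGroup (Fin 2) (ZMod d) × ZMod d × ZMod d) :
    symplecticPair t ∈ Set.range (cliffPair (d := d)) := by
  obtain ⟨⟨m, hm⟩, i, j⟩ := t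
  rw [Matrix.det_fin_two] at hm
  set a : ℂ := ZMod.stdAddChar i * weylPhase (m 0 0) (m 1 0) with ha
  set b : ℂ := ZMod.stdAddChar j * weylPhase (m 0 1) (m 1 1) with hb
  set A : Matrix (Fin d) (Fin d) ℂ := a • weyl (m 0 0) (m 1 0) with hA
  set B : Matrix (Fin d) (Fin d) ℂ := b • weyl (m 0 1) (m 1 1) with hB
  have hna : ‖a‖ = 1 := by rw [ha, norm_mul, AddChar.norm_apply, norm_weylPhase, one_mul]
  have hnb : ‖b‖ = 1 := by rw [hb, norm_mul, AddChar.norm_apply, norm_weylPhase, one_mul]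
  have hunit : ∀ (c : ℂ), ‖c‖ = 1 → ∀ x y : ZMod d, (c • weyl x y)ᴴ * (c • weyl x y) = 1 := by
    intro c hc x y
    rw [Matrix.conjTranspose_smul, Matrix.smul_mul, Matrix.mul_smul, smul_smul,
      mul_eq_one_comm.1 (weyl_mul_conjTranspose x y), ← starRingEnd_apply, mul_comm,
      Complex.mul_conj, Complex.normSq_eq_norm_sq, hc]
    simp
  have hpow : ∀ k x y : ZMod d, ((ZMod.stdAddChar k * weylPhase x y) • weyl x y) ^ d = 1 := by
    intro k x y
    rw [mul_smul, smul_pow, weylPhase_smul_pow, stdAddChar_pow_card, one_smul]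
  have hAB : B * A = (ZMod.stdAddChar (1 : ZMod d) : ℂ) • (A * B) := by
    rw [hA, hB, Matrix.smul_mul, Matrix.mul_smul, Matrix.smul_mul, Matrix.mul_smul,
      weyl_mul_comm (m 0 0) (m 1 0), show m 1 1 * m 0 0 - m 1 0 * m 0 1 = 1 by rw [← hm]; ring]
    simp only [smul_smul]
    ring_nf
  obtain ⟨U, hU, hUS, hUT⟩ := exists_unitary_intertwiner (hunit a hna _ _) (hunit b hnb _ _)
    (hpow _ _ _) (hpow _ _ _) hAB
  have hU' := mul_eq_one_comm.1 hU
  have hconjS : U * weyl 1 0 * Uᴴ = A := by rw [hUS, Matrix.mul_assoc, hU', Matrix.mul_one]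
  have hconjT : U * weyl 0 1 * Uᴴ = B := by rw [hUT, Matrix.mul_assoc, hU', Matrix.mul_one]
  have hconj : ∀ x y : ZMod d, ∃ c : ℂ, ‖c‖ = 1 ∧ U * weyl x y * Uᴴ =
      c • weyl (x * m 0 0 + y * m 0 1) (x * m 1 0 + y * m 1 1) := by
    intro x y
    obtain ⟨c, hc, hcx⟩ := weyl_pow (m 0 0) (m 1 0) x.val
    obtain ⟨e, he, hey⟩ := weyl_pow (m 0 1) (m 1 1) y.val
    rw [ZMod.natCast_zmod_val] at hcx hey
    rw [weyl_eq_pow, ← unitary_conj_mul_conj hU, ← unitary_conj_pow hU, ← unitary_conj_pow hU, hconjS, hconjT, hA, hB,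
      smul_pow, smul_pow, hcx, hey, Matrix.smul_mul, Matrix.smul_mul, Matrix.mul_smul,
      Matrix.mul_smul, weyl_mul_weyl]
    simp only [smul_smul]
    exact ⟨_, by simp [hna, hnb, hc, he, AddChar.norm_apply], rfl⟩
  have hCliff : (fun M => U * M * Uᴴ) '' Wset d = Wset d := by
    ext M
    constructor
    · rintro ⟨N, hN, rfl⟩
      obtain ⟨c, hc, x, y, rfl⟩ := mem_Wset_iff.1 hN
      obtain ⟨e, he, h⟩ := hconj x y
      refine mem_Wset_iff.2 ⟨c * e, by rw [norm_mul, hc, he, one_mul],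
        x * m 0 0 + y * m 0 1, x * m 1 0 + y * m 1 1, ?_⟩
      simp only [Matrix.mul_smul, Matrix.smul_mul]
      rw [h, smul_smul]
    · intro hM
      obtain ⟨c, hc, u, v, rfl⟩ := mem_Wset_iff.1 hM
      obtain ⟨e, he, h⟩ := hconj (m 1 1 * u - m 0 1 * v) (m 0 0 * v - m 1 0 * u)
      have hu : (m 1 1 * u - m 0 1 * v) * m 0 0 + (m 0 0 * v - m 1 0 * u) * m 0 1 = u := by
        linear_combination u * hm
      have hv : (m 1 1 * u - m 0 1 * v) * m 1 0 + (m 0 0 * v - m 1 0 * u) * m 1 1 = v := by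
        linear_combination v * hm
      have he0 : e ≠ 0 := by
        rw [← norm_ne_zero_iff, he]
        exact one_ne_zero
      rw [hu, hv] at h
      refine ⟨(c / e) • weyl (m 1 1 * u - m 0 1 * v) (m 0 0 * v - m 1 0 * u),
        mem_Wset_iff.2 ⟨c / e, by rw [norm_div, hc, he, div_one], _, _, rfl⟩, ?_⟩
      simp only [Matrix.mul_smul, Matrix.smul_mul]
      rw [h, smul_smul, div_mul_cancel₀ _ he0]
  exact ⟨⟨⟨U, Matrix.mem_unitaryGroup_iff'.2 hU⟩, hCliff⟩, Prod.ext hconjS hconjT⟩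

lemma range_cliffPair : Set.range (cliffPair (d := d)) = Set.range (symplecticPair (d := d)) :=
  Set.Subset.antisymm (Set.range_subset_iff.2 cliffPair_mem_range)
    (Set.range_subset_iff.2 symplecticPair_mem_range)

end Clifford

/-- For prime `d`, `|C(d)/Cc(d)| = d³(d²−1)`. -/
theorem stmt8 (d : ℕ) (hp : d.Prime) :
    Nat.card (Cliff d ⧸ CcSub d) = d ^ 3 * (d ^ 2 - 1) := by
  have : Fact d.Prime := ⟨hp⟩
  rw [card_quotient_eq, range_cliffPair,
    ← Nat.card_congr (Equiv.ofInjective _ symplecticPair_injective), Nat.card_prod, Nat.card_prod,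
    card_SL_two, Nat.card_zmod, ZMod.card]
  ring
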